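/- arXiv:1904.01465 — 2 statements merged into one kernel-verified Lean document; each statement's English description precedes it below -/
import Mathlib

section
/- With the data of two composable morphisms of pointed finite G-sets f = (q, A_f, f̄) : (A → R) → (B → S) and g = (p, B_g, ḡ) : (B → S) → (C → T) as below, let A_{gf} = {a ∈ p*A_f : (p*f̄)(a) ∈ B_g} ⊆ p*A_f and let the composite map be ḡf = ḡ ∘ (p*f̄)|_{A_{gf}} : A_{gf} → C. Then for every G-orbit W ⊆ C there is a canonical G-equivariant bijection between the preimage (ḡf)⁻¹(W) ⊆ A_{gf} and the disjoint union, over the G-orbits V̄ of ḡ⁻¹(W) ⊆ B_g, of the pullbacks p_{V̄}*( f̄⁻¹(p(V̄)) ) = V̄ ×_{p(V̄)} f̄⁻¹(p(V̄)), where the pullback is formed along the restricted projection p_{V̄} : V̄ → p(V̄) and the restriction of f̄ to f̄⁻¹(p(V̄)). -/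
open MulAction

section

variable (G : Type*) [Group G]
variable {S T A B : Type*} [MulAction G S] [MulAction G T] [MulAction G A] [MulAction G B]

/-- The set of `G`-orbits contained in (i.e. of elements of) a subset `P` of a `G`-set. -/
abbrev OrbitsOf {X : Type*} [MulAction G X] (P : Set X) :=
  {O : Set X // ∃ x ∈ P, O = orbit G x}

/-- The disjoint union, over the `G`-orbits `V̄` of `P = ḡ⁻¹(W) ⊆ B_g ⊆ T × B`, of the
pullbacks `p_{V̄}*(f̄⁻¹(p(V̄))) = V̄ ×_{p(V̄)} f̄⁻¹(p(V̄))`, formed along the restricted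
projection `p_{V̄} : V̄ → p(V̄)`, `v̄ ↦ v̄.2`, and the restriction of `f̄`; here
`p(V̄) = Prod.snd '' V̄` is the image orbit of `V̄` in `B`. -/
abbrev CompOrbitPullbackSum (P : Set (T × B)) (Af : SubMulAction G (S × A))
    (fbar : Af → B) :=
  Σ O : OrbitsOf G P,
    {y : (T × B) × Af //
      y.1 ∈ (O : Set (T × B)) ∧ fbar y.2 ∈ Prod.snd '' (O : Set (T × B)) ∧
        y.1.2 = fbar y.2}

end

namespace OrbitsOf

variable {G X : Type*} [Group G] [MulAction G X] {P : Set X}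

theorem eq_orbit (O : OrbitsOf G P) {x : X} (hx : x ∈ (O : Set X)) :
    (O : Set X) = orbit G x := by
  obtain ⟨y, -, hy⟩ := O.2
  rw [hy] at hx ⊢
  exact (orbit_eq_iff.mpr hx).symm

theorem smul_mem (O : OrbitsOf G P) (g : G) {x : X} (hx : x ∈ (O : Set X)) :
    g • x ∈ (O : Set X) := by
  rw [O.eq_orbit hx]
  exact mem_orbit x g

theorem mem_of_mem (hP : ∀ (g : G), ∀ x ∈ P, g • x ∈ P) (O : OrbitsOf G P) {x : X}
    (hx : x ∈ (O : Set X)) : x ∈ P := by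
  obtain ⟨_, y, hy, rfl⟩ := O
  obtain ⟨g, rfl⟩ := hx
  exact hP g y hy

end OrbitsOf

/-- for composable morphisms `f = (q, A_f, f̄)` and `g = (p, B_g, ḡ)` of
pointed finite `G`-sets, with composite `ḡf : A_{gf} → C`, and for every `G`-orbit
`W ⊆ C`, there is a canonical `G`-equivariant bijection
`(ḡf)⁻¹(W) ≅ ⨿_{V̄ ∈ (ḡ⁻¹W)/G} V̄ ×_{p(V̄)} f̄⁻¹(p(V̄))`. -/
theorem comp_preimage_orbit_decomposition
    {G : Type*} [Group G] [Fintype G]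
    {R S T A B C : Type*}
    [MulAction G R] [MulAction G S] [MulAction G T]
    [MulAction G A] [MulAction G B] [MulAction G C]
    [Fintype R] [Fintype S] [Fintype T] [Fintype A] [Fintype B] [Fintype C]
    (hR : IsPretransitive G R) (hS : IsPretransitive G S) (hT : IsPretransitive G T)
    (α : A → R) (hα : ∀ (g : G) (a : A), α (g • a) = g • α a)
    (β : B → S) (hβ : ∀ (g : G) (b : B), β (g • b) = g • β b)
    (γ : C → T) (hγ : ∀ (g : G) (c : C), γ (g • c) = g • γ c)
    -- the morphism `f = (q, A_f, f̄) : (A → R) → (B → S)`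
    (q : S → R) (hq : ∀ (g : G) (s : S), q (g • s) = g • q s)
    (Af : SubMulAction G (S × A))
    (hAf : ∀ x ∈ Af, q x.1 = α x.2)
    (fbar : Af → B)
    (hfbar : ∀ (g : G) (x : Af), fbar (g • x) = g • fbar x)
    (hfbarS : ∀ x : Af, β (fbar x) = (x : S × A).1)
    -- the morphism `g = (p, B_g, ḡ) : (B → S) → (C → T)`
    (p : T → S) (hp : ∀ (g : G) (t : T), p (g • t) = g • p t)
    (Bg : SubMulAction G (T × B))
    (hBg : ∀ x ∈ Bg, p x.1 = β x.2)
    (gbar : Bg → C)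
    (hgbar : ∀ (g : G) (x : Bg), gbar (g • x) = g • gbar x)
    (hgbarT : ∀ x : Bg, γ (gbar x) = (x : T × B).1)
    -- a `G`-orbit `W ⊆ C`
    (W : Set C) (hW : ∃ c : C, W = orbit G c) :
    -- `ḡ⁻¹(W) ⊆ B_g` is the set over whose orbits the disjoint union is taken, and
    -- `(ḡf)⁻¹(W) ⊆ A_{gf} ⊆ p*A_f` is the preimage of `W` under the composite `ḡf`,
    -- where `A_{gf} = {(t,a) ∈ p*A_f : (t, f̄ a) ∈ B_g}` and `ḡf (t,a) = ḡ (t, f̄ a)`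
    ∃ (Φ : CompOrbitPullbackSum G {x : T × B | ∃ h : x ∈ Bg, gbar ⟨x, h⟩ ∈ W} Af fbar →
           {z : T × Af // ∃ h : (z.1, fbar z.2) ∈ Bg,
              p z.1 = (z.2 : S × A).1 ∧ gbar ⟨(z.1, fbar z.2), h⟩ ∈ W})
      (σ : G → CompOrbitPullbackSum G {x : T × B | ∃ h : x ∈ Bg, gbar ⟨x, h⟩ ∈ W} Af fbar →
             CompOrbitPullbackSum G {x : T × B | ∃ h : x ∈ Bg, gbar ⟨x, h⟩ ∈ W} Af fbar)
      (τ : G → {z : T × Af // ∃ h : (z.1, fbar z.2) ∈ Bg,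
                  p z.1 = (z.2 : S × A).1 ∧ gbar ⟨(z.1, fbar z.2), h⟩ ∈ W} →
             {z : T × Af // ∃ h : (z.1, fbar z.2) ∈ Bg,
                p z.1 = (z.2 : S × A).1 ∧ gbar ⟨(z.1, fbar z.2), h⟩ ∈ W}),
      -- `σ` is the componentwise `G`-action on the disjoint union (preserving each
      -- orbit summand)
      (∀ (g : G) w, (σ g w).1 = w.1 ∧
        ((σ g w).2 : (T × B) × Af) = (g • (w.2 : (T × B) × Af).1, g • (w.2 : (T × B) × Af).2)) ∧
      -- `τ` is the componentwise `G`-action on the preimage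
      (∀ (g : G) z, ((τ g z) : T × Af) = (g • (z : T × Af).1, g • (z : T × Af).2)) ∧
      -- `Φ` is the canonical map `((t, b), a) ↦ (t, a)`
      (∀ w, (Φ w : T × Af) = ((w.2 : (T × B) × Af).1.1, (w.2 : (T × B) × Af).2)) ∧
      -- which is bijective and `G`-equivariant
      Function.Bijective Φ ∧
      (∀ (g : G) w, Φ (σ g w) = τ g (Φ w)) := by
  have hWsmul : ∀ (g : G), ∀ c ∈ W, g • c ∈ W := by
    obtain ⟨c, rfl⟩ := hW
    exact fun g _ hd => mem_orbit_of_mem_orbit g hd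
  have hP : ∀ (g : G), ∀ x ∈ {x : T × B | ∃ h : x ∈ Bg, gbar ⟨x, h⟩ ∈ W},
      g • x ∈ {x : T × B | ∃ h : x ∈ Bg, gbar ⟨x, h⟩ ∈ W} := by
    rintro g x ⟨h, hx⟩
    refine ⟨Bg.smul_mem g h, ?_⟩
    have := hWsmul g _ hx
    rwa [← hgbar] at this
  have hpS : ∀ z : T × Af, (z.1, fbar z.2) ∈ Bg → p z.1 = (z.2 : S × A).1 := fun z h =>
    (hBg _ h).trans (hfbarS z.2)
  refine ⟨fun w => ⟨(w.2.1.1.1, w.2.1.2), ?_⟩,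
    fun g w => ⟨w.1, (g • w.2.1.1, g • w.2.1.2), w.1.smul_mem g w.2.2.1, ?_, ?_⟩,
    fun g z => ⟨(g • z.1.1, g • z.1.2), ?_⟩,
    fun _ _ => ⟨rfl, rfl⟩, fun _ _ => rfl, fun _ => rfl, ⟨?_, ?_⟩, fun _ _ => rfl⟩
  · obtain ⟨O, ⟨⟨t, b⟩, a⟩, hO, -, rfl : b = fbar a⟩ := w
    obtain ⟨h, hW'⟩ := O.mem_of_mem hP hO
    exact ⟨h, hpS (t, a) h, hW'⟩
  · exact ⟨g • w.2.1.1, w.1.smul_mem g w.2.2.1,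
      (congrArg (g • ·) w.2.2.2.2).trans (hfbar g _).symm⟩
  · exact (congrArg (g • ·) w.2.2.2.2).trans (hfbar g _).symm
  · obtain ⟨⟨t, a⟩, h, -, hW'⟩ := z
    obtain ⟨h', hW''⟩ := hP g (t, fbar a) ⟨h, hW'⟩
    have hga : ((g • t, fbar (g • a)) : T × B) = g • (t, fbar a) :=
      Prod.ext rfl (hfbar g a)
    have hmem : ((g • t, fbar (g • a)) : T × B) ∈ Bg := hga ▸ h'
    refine ⟨hmem, hpS (g • t, g • a) hmem, ?_⟩
    simpa only [hga] using hW''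
  · rintro ⟨O, ⟨⟨t, b⟩, a⟩, hO, hb, rfl : b = fbar a⟩
      ⟨O', ⟨⟨t', b'⟩, a'⟩, hO', hb', rfl : b' = fbar a'⟩ h
    obtain ⟨rfl : t = t', rfl : a = a'⟩ := Prod.ext_iff.mp (Subtype.ext_iff.mp h)
    obtain rfl : O = O' := Subtype.ext ((O.eq_orbit hO).trans (O'.eq_orbit hO').symm)
    rfl
  · rintro ⟨⟨t, a⟩, h, hp', hW'⟩
    exact ⟨⟨⟨orbit G (t, fbar a), _, ⟨h, hW'⟩, rfl⟩, ((t, fbar a), a), mem_orbit_self _,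
      ⟨_, mem_orbit_self _, rfl⟩, rfl⟩, rfl⟩
end

section
/- With the data of a morphism f = (q, A_f, f̄) of pointed finite G-sets and a G-map p : T → S as below, for every G-orbit V ⊆ B there is a canonical G-equivariant bijection between the disjoint union, over the G-orbits V̄ of the preimage p⁻¹(V) ⊆ p*B of V under the projection p : p*B → B, of the pullbacks p_{V̄}*( f̄⁻¹(V) ) = V̄ ×_V f̄⁻¹(V) (formed along p_{V̄} : V̄ → V and the restriction of f̄), and the preimage (p*f̄)⁻¹( p⁻¹(V) ) ⊆ p*A_f of p⁻¹(V) under the induced map p*f̄ : p*A_f → p*B. -/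
open MulAction

section

variable (G : Type*) [Group G]
variable {S T A B : Type*} [MulAction G S] [MulAction G T] [MulAction G A] [MulAction G B]

/-- The disjoint union, over the `G`-orbits `V̄` of `P ⊆ p*B ⊆ T × B`, of the pullbacks
`V̄ ×_V f̄⁻¹(V)` formed along the projection `p_{V̄} : V̄ → V`, `v̄ ↦ v̄.2`, and `f̄`. -/
abbrev OrbitPullbackSum (P : Set (T × B)) (Af : SubMulAction G (S × A))
    (fbar : Af → B) (V : Set B) :=
  Σ O : OrbitsOf G P, {y : (T × B) × Af // y.1 ∈ O.1 ∧ fbar y.2 ∈ V ∧ y.1.2 = fbar y.2}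

/-- `p*A_f`, the pullback of `A_f → S` along `p : T → S`, intersected with the preimage
of `p⁻¹(V)` under `p*f̄`; concretely, pairs `(t, a)` with `p t = (the S-component of a)`
and `f̄(a) ∈ V`. -/
abbrev PullbackPreimage (p : T → S) (Af : SubMulAction G (S × A))
    (fbar : Af → B) (V : Set B) :=
  {z : T × Af // p z.1 = (z.2 : S × A).1 ∧ fbar z.2 ∈ V}

end

theorem OrbitsOf.eq_of_mem {G X : Type*} [Group G] [MulAction G X] {P : Set X}
    {O O' : OrbitsOf G P} {x : X} (hx : x ∈ O.1) (hx' : x ∈ O'.1) : O = O' := by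
  obtain ⟨y, -, hy⟩ := O.2
  obtain ⟨y', -, hy'⟩ := O'.2
  rw [hy] at hx
  rw [hy'] at hx'
  rw [Subtype.ext_iff, hy, hy']
  exact (orbit_eq_iff.mpr hx).symm.trans (orbit_eq_iff.mpr hx')

theorem OrbitsOf.smul_mem_s5 {G X : Type*} [Group G] [MulAction G X] {P : Set X}
    (O : OrbitsOf G P) (g : G) {x : X} (hx : x ∈ O.1) : g • x ∈ O.1 := by
  obtain ⟨y, -, hy⟩ := O.2
  rw [hy] at hx ⊢
  exact mem_orbit_of_mem_orbit g hx

theorem OrbitsOf.mem_of_mem_s5 {G X : Type*} [Group G] [MulAction G X] {P : Set X}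
    (hP : ∀ (g : G), ∀ x ∈ P, g • x ∈ P) (O : OrbitsOf G P) {x : X} (hx : x ∈ O.1) : x ∈ P := by
  obtain ⟨y, hy, hO⟩ := O.2
  rw [hO] at hx
  obtain ⟨g, rfl⟩ := hx
  exact hP g y hy

/-- for every `G`-orbit `V ⊆ B`, there is a canonical `G`-equivariant
bijection `⨿_{V̄ ∈ (p⁻¹V)/G} V̄ ×_V f̄⁻¹(V) ≅ (p*f̄)⁻¹(p⁻¹(V))`. -/
theorem orbit_pullback_sum_bijection
    {G : Type*} [Group G] [Fintype G]
    {R S T A B : Type*}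
    [MulAction G R] [MulAction G S] [MulAction G T] [MulAction G A] [MulAction G B]
    [Fintype R] [Fintype S] [Fintype T] [Fintype A] [Fintype B]
    (hR : IsPretransitive G R) (hS : IsPretransitive G S) (hT : IsPretransitive G T)
    (α : A → R) (hα : ∀ (g : G) (a : A), α (g • a) = g • α a)
    (β : B → S) (hβ : ∀ (g : G) (b : B), β (g • b) = g • β b)
    (q : S → R) (hq : ∀ (g : G) (s : S), q (g • s) = g • q s)
    (Af : SubMulAction G (S × A))
    (hAf : ∀ x ∈ Af, q x.1 = α x.2)
    (fbar : Af → B)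
    (hfbar : ∀ (g : G) (x : Af), fbar (g • x) = g • fbar x)
    (hfbarS : ∀ x : Af, β (fbar x) = (x : S × A).1)
    (p : T → S) (hp : ∀ (g : G) (t : T), p (g • t) = g • p t)
    (V : Set B) (hV : ∃ b : B, V = orbit G b) :
    ∃ (Φ : OrbitPullbackSum G {x : T × B | p x.1 = β x.2 ∧ x.2 ∈ V} Af fbar V →
           PullbackPreimage G p Af fbar V)
      (σ : G → OrbitPullbackSum G {x : T × B | p x.1 = β x.2 ∧ x.2 ∈ V} Af fbar V →
             OrbitPullbackSum G {x : T × B | p x.1 = β x.2 ∧ x.2 ∈ V} Af fbar V)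
      (τ : G → PullbackPreimage G p Af fbar V → PullbackPreimage G p Af fbar V),
      -- `σ` is the componentwise `G`-action on the disjoint union (preserving each orbit summand)
      (∀ (g : G) w, (σ g w).1 = w.1 ∧
        ((σ g w).2 : (T × B) × Af) = (g • (w.2 : (T × B) × Af).1, g • (w.2 : (T × B) × Af).2)) ∧
      -- `τ` is the componentwise `G`-action on the preimage
      (∀ (g : G) z, ((τ g z) : T × Af) = (g • (z : T × Af).1, g • (z : T × Af).2)) ∧
      -- `Φ` is the canonical map `((t, b), a) ↦ (t, a)`
      (∀ w, (Φ w : T × Af) = ((w.2 : (T × B) × Af).1.1, (w.2 : (T × B) × Af).2)) ∧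
      -- which is bijective and `G`-equivariant
      Function.Bijective Φ ∧
      (∀ (g : G) w, Φ (σ g w) = τ g (Φ w)) := by
  have hVs : ∀ (g : G), ∀ b ∈ V, g • b ∈ V := by
    obtain ⟨b, rfl⟩ := hV
    exact fun g _ hc => mem_orbit_of_mem_orbit g hc
  have hP : ∀ (g : G), ∀ x ∈ {x : T × B | p x.1 = β x.2 ∧ x.2 ∈ V},
      g • x ∈ {x : T × B | p x.1 = β x.2 ∧ x.2 ∈ V} := by
    rintro g ⟨t, b⟩ ⟨h, hb⟩
    exact ⟨(hp g t).trans ((congrArg (g • ·) h).trans (hβ g b).symm), hVs g b hb⟩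
  refine ⟨fun w => ⟨(w.2.1.1.1, w.2.1.2), ?_, w.2.2.2.1⟩,
    fun g w => ⟨w.1, (g • w.2.1.1, g • w.2.1.2), w.1.smul_mem_s5 g w.2.2.1, ?_, ?_⟩,
    fun g z => ⟨(g • z.1.1, g • z.1.2), ?_, ?_⟩,
    fun _ _ => ⟨rfl, rfl⟩, fun _ _ => rfl, fun _ => rfl, ⟨?_, ?_⟩, fun _ _ => rfl⟩
  · have h := (OrbitsOf.mem_of_mem_s5 hP w.1 w.2.2.1).1
    rw [w.2.2.2.2, hfbarS] at h
    exact h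
  · rw [hfbar]
    exact hVs g _ w.2.2.2.1
  · rw [hfbar, ← w.2.2.2.2]
    rfl
  · exact (hp g _).trans (congrArg (g • ·) z.2.1)
  · rw [hfbar]
    exact hVs g _ z.2.2
  · rintro ⟨O, ⟨⟨t, b⟩, a⟩, hO, hV₁, hb⟩ ⟨O', ⟨⟨t', b'⟩, a'⟩, hO', hV₂, hb'⟩ h
    obtain ⟨rfl, rfl⟩ := Prod.ext_iff.mp (Subtype.ext_iff.mp h)
    dsimp only at hb hb'
    subst hb hb'
    obtain rfl := OrbitsOf.eq_of_mem hO hO'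
    rfl
  · rintro ⟨⟨t, a⟩, h, ha⟩
    exact ⟨⟨⟨orbit G (t, fbar a), (t, fbar a), ⟨h.trans (hfbarS a).symm, ha⟩, rfl⟩,
      ((t, fbar a), a), mem_orbit_self _, ha, rfl⟩, rfl⟩
end
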